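/- Let Ω ∈ (0,1) be a quadratic irrational with purely periodic continued fraction and associated data T = [[a,b],[c,d]], U, λ, γ*, γ̃*_q. For any primitive integer q such that the vectors of the resonant sequence s(q,n) = Uⁿk⁰(q) are not resonant convergents (i.e. no s(q,n) equals any v(j) = (−p_j,q_j)), the normalized limit numerator satisfies γ̃*_q > √5/2. -/

import Mathlib

open Real Filter Matrix

noncomputable section

/-- Orbit of the Gauss map `g(x) = {1/x}` starting at `Ω`:
`x₀ = Ω`, `x_{j+1} = g(x_j)`. -/
def gaussOrbit (Ω : ℝ) : ℕ → ℝ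
  | 0 => Ω
  | j + 1 => Int.fract (1 / gaussOrbit Ω j)

/-- `cfA Ω j` is the partial quotient `a_{j+1}` of the continued fraction of `Ω`. -/
def cfA (Ω : ℝ) (j : ℕ) : ℤ := ⌊1 / gaussOrbit Ω j⌋

/-- The matrix `[[a, 1], [1, 0]]`. -/
def Acf (a : ℤ) : Matrix (Fin 2) (Fin 2) ℤ := !![a, 1; 1, 0]

/-- The product `A₁ ⋯ A_m` with `A_i = [[a_i, 1], [1, 0]]`. -/
def cfMatProd (Ω : ℝ) (m : ℕ) : Matrix (Fin 2) (Fin 2) ℤ :=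
  ((List.range m).map fun i => Acf (cfA Ω i)).prod

/-- `cfQ Ω (j+1) = q_j`:  `q₋₁ = 0`, `q₀ = 1`, `q_j = a_j q_{j-1} + q_{j-2}`. -/
def cfQ (Ω : ℝ) : ℕ → ℤ
  | 0 => 0
  | 1 => 1
  | j + 2 => cfA Ω j * cfQ Ω (j + 1) + cfQ Ω j

/-- `cfP Ω (j+1) = p_j`:  `p₋₁ = 1`, `p₀ = 0`, `p_j = a_j p_{j-1} + p_{j-2}`. -/
def cfP (Ω : ℝ) : ℕ → ℤ
  | 0 => 1
  | 1 => 0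
  | j + 2 => cfA Ω j * cfP Ω (j + 1) + cfP Ω j

/-- The vector convergent `w(j) = (q_j, p_j)`. -/
def wconv (Ω : ℝ) (j : ℕ) : Fin 2 → ℤ := ![cfQ Ω (j + 1), cfP Ω (j + 1)]

/-- The resonant convergent `v(j) = (−p_j, q_j)`. -/
def vconv (Ω : ℝ) (j : ℕ) : Fin 2 → ℤ := ![-cfP Ω (j + 1), cfQ Ω (j + 1)]

/-- A quadratic irrational number. -/
def IsQuadraticIrrational (Ω : ℝ) : Prop :=
  Irrational Ω ∧ ∃ A B C : ℤ, A ≠ 0 ∧ (A : ℝ) * Ω ^ 2 + (B : ℝ) * Ω + (C : ℝ) = 0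

end
noncomputable section

/-- `⟨k, ω⟩ = k₁ + k₂ Ω` for `ω = (1, Ω)`. -/
def pairω (Ω : ℝ) (k : Fin 2 → ℤ) : ℝ := (k 0 : ℝ) + (k 1 : ℝ) * Ω

/-- `|k|₁ = |k₁| + |k₂|`. -/
def norm1 (k : Fin 2 → ℤ) : ℤ := |k 0| + |k 1|

/-- `p⁰(q)`: the integer nearest to `qΩ`. -/
def p0 (Ω : ℝ) (q : ℤ) : ℤ := round ((q : ℝ) * Ω)

/-- `k⁰(q) = (−p⁰(q), q)`. -/
def kzero (Ω : ℝ) (q : ℤ) : Fin 2 → ℤ := ![-p0 Ω q, q]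

/-- The set `A` of quasi-resonances: vectors `k⁰(q)`, `q ≥ 1`, with `|⟨k,ω⟩| < 1/2`. -/
def inA (Ω : ℝ) (k : Fin 2 → ℤ) : Prop :=
  ∃ q : ℤ, 1 ≤ q ∧ k = kzero Ω q ∧ |pairω Ω k| < 1 / 2

/-- A quasi-resonance `k` is primitive if `U⁻¹k` is not a quasi-resonance. -/
def PrimitiveVec (Ω : ℝ) (U : Matrix (Fin 2) (Fin 2) ℤ) (k : Fin 2 → ℤ) : Prop :=
  inA Ω k ∧ ¬inA Ω (U⁻¹.mulVec k)

/-- A primitive integer `q ≥ 1`. -/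
def PrimitiveInt (Ω : ℝ) (U : Matrix (Fin 2) (Fin 2) ℤ) (q : ℤ) : Prop :=
  1 ≤ q ∧ PrimitiveVec Ω U (kzero Ω q)

/-- The resonant sequence `s(q, n) = Uⁿ k⁰(q)`. -/
def sres (Ω : ℝ) (U : Matrix (Fin 2) (Fin 2) ℤ) (q : ℤ) (n : ℕ) : Fin 2 → ℤ :=
  (U ^ n).mulVec (kzero Ω q)

/-- `U = σ (T⁻¹)ᵀ` with `σ = det T = (−1)^m` and `T = A₁⋯A_m`. -/
def Umat (Ω : ℝ) (m : ℕ) : Matrix (Fin 2) (Fin 2) ℤ :=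
  ((-1 : ℤ) ^ m) • ((cfMatProd Ω m)⁻¹)ᵀ

/-- The numerator `γ_k = |⟨k,ω⟩| · |k|₁`. -/
def gammaK (Ω : ℝ) (k : Fin 2 → ℤ) : ℝ := |pairω Ω k| * (norm1 k : ℝ)

/-- `K_q = |z_q|(1+Ω)/|c+bΩ²|`, where `z_q = cq + bpΩ`, `p = p⁰(q)`,
and `b, c` are the off-diagonal entries of `T = A₁⋯A_m = [[a,b],[c,d]]`. -/
def KqD (Ω : ℝ) (m : ℕ) (q : ℤ) : ℝ :=
  |(cfMatProd Ω m 1 0 : ℝ) * (q : ℝ) + (cfMatProd Ω m 0 1 : ℝ) * (p0 Ω q : ℝ) * Ω| * (1 + Ω) /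
    |(cfMatProd Ω m 1 0 : ℝ) + (cfMatProd Ω m 0 1 : ℝ) * Ω ^ 2|

/-- The limit numerator `γ*_q = |r_q| K_q` with `r_q = qΩ − p⁰(q)`. -/
def gammaStarQ (Ω : ℝ) (m : ℕ) (q : ℤ) : ℝ :=
  |(q : ℝ) * Ω - (p0 Ω q : ℝ)| * KqD Ω m q

end


lemma gaussOrbit_shift (x : ℝ) (j : ℕ) :
    gaussOrbit x (j + 1) = gaussOrbit (Int.fract (1 / x)) j := by
  induction j with
  | zero => simp [gaussOrbit]
  | succ j ih => rw [gaussOrbit, ih, gaussOrbit]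

lemma cfA_shift (x : ℝ) (j : ℕ) : cfA x (j + 1) = cfA (Int.fract (1 / x)) j := by
  rw [cfA, cfA, gaussOrbit_shift]

lemma cfPQ_shift (x : ℝ) (j : ℕ) :
    (cfP x (j + 1) = cfQ (Int.fract (1 / x)) j ∧
      cfQ x (j + 1) = ⌊1 / x⌋ * cfQ (Int.fract (1 / x)) j + cfP (Int.fract (1 / x)) j) ∧
    (cfP x (j + 2) = cfQ (Int.fract (1 / x)) (j + 1) ∧
      cfQ x (j + 2) = ⌊1 / x⌋ * cfQ (Int.fract (1 / x)) (j + 1)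
        + cfP (Int.fract (1 / x)) (j + 1)) := by
  induction j with
  | zero => simp [cfP, cfQ, cfA, gaussOrbit]
  | succ j ih =>
    obtain ⟨⟨h1, h2⟩, h3, h4⟩ := ih
    refine ⟨⟨h3, h4⟩, ?_, ?_⟩
    · rw [cfP, cfQ, h3, h1, cfA_shift]
    · have e1 : cfQ (Int.fract (1 / x)) (j + 1 + 1) = cfA (Int.fract (1 / x)) j *
          cfQ (Int.fract (1 / x)) (j + 1) + cfQ (Int.fract (1 / x)) j := by rw [cfQ]
      have e2 : cfP (Int.fract (1 / x)) (j + 1 + 1) = cfA (Int.fract (1 / x)) j *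
          cfP (Int.fract (1 / x)) (j + 1) + cfP (Int.fract (1 / x)) j := by rw [cfP]
      have e3 : cfQ x (j + 1 + 2) = cfA x (j + 1) * cfQ x (j + 2) + cfQ x (j + 1) := by rw [cfQ]
      rw [e1, e2, e3, h2, h4, cfA_shift]; ring

lemma gauss_irr {x : ℝ} (hx : Irrational x) (_h0 : 0 < x) (_h1 : x < 1) :
    Irrational (Int.fract (1 / x)) ∧ 0 < Int.fract (1 / x) ∧ Int.fract (1 / x) < 1 := by
  have h : Irrational (Int.fract (1 / x)) := by
    rw [one_div, Int.fract]
    exact hx.inv.sub_intCast _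
  refine ⟨h, lt_of_le_of_ne (Int.fract_nonneg _) (fun e => ?_), Int.fract_lt_one _⟩
  exact h.ne_zero e.symm

lemma orbit_irr {x : ℝ} (hx : Irrational x) (h0 : 0 < x) (h1 : x < 1) (j : ℕ) :
    Irrational (gaussOrbit x j) ∧ 0 < gaussOrbit x j ∧ gaussOrbit x j < 1 := by
  induction j with
  | zero => exact ⟨hx, h0, h1⟩
  | succ j ih => exact gauss_irr ih.1 ih.2.1 ih.2.2

lemma cfA_pos {x : ℝ} (hx : Irrational x) (h0 : 0 < x) (h1 : x < 1) (j : ℕ) : 1 ≤ cfA x j := by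
  obtain ⟨_, a, b⟩ := orbit_irr hx h0 h1 j
  rw [cfA, Int.le_floor]
  push_cast
  rw [le_div_iff₀ a]; linarith

lemma cfQ_pos {x : ℝ} (hx : Irrational x) (h0 : 0 < x) (h1 : x < 1) (j : ℕ) :
    0 ≤ cfQ x j ∧ 0 < cfQ x (j + 1) := by
  induction j with
  | zero => simp [cfQ]
  | succ j ih =>
    refine ⟨ih.2.le, ?_⟩
    rw [cfQ]
    have := mul_pos (lt_of_lt_of_le one_pos (cfA_pos hx h0 h1 j)) ih.2
    linarith [ih.1]

lemma cfPQ_det (x : ℝ) (j : ℕ) :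
    cfP x j * cfQ x (j + 1) - cfP x (j + 1) * cfQ x j = (-1) ^ j := by
  induction j with
  | zero => simp [cfQ, cfP]
  | succ j ih =>
    rw [cfQ, cfP, pow_succ, ← ih]; ring

lemma cfPQ_coprime (x : ℝ) (j : ℕ) : IsCoprime (cfP x j) (cfQ x j) := by
  have h := cfPQ_det x j
  have h2 : ((-1 : ℤ) ^ j) * (-1) ^ j = 1 := by rw [← mul_pow]; simp
  refine ⟨(-1) ^ j * cfQ x (j + 1), -(-1) ^ j * cfP x (j + 1), ?_⟩
  linear_combination (-1) ^ j * h + h2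

lemma convergent_fract (y : ℝ) (n : ℕ) :
    y.convergent n = ⌊y⌋ + (Int.fract y).convergent n := by
  cases n with
  | zero => simp
  | succ n => simp

lemma convergent_eq (n : ℕ) : ∀ {x : ℝ}, Irrational x → 0 < x → x < 1 →
    x.convergent n = (cfP x (n + 1) : ℚ) / (cfQ x (n + 1) : ℚ) := by
  induction n with
  | zero =>
    intro x hx h0 h1
    have : ⌊x⌋ = 0 := by rw [Int.floor_eq_zero_iff]; exact ⟨h0.le, h1⟩
    simp [cfP, this]
  | succ n ih =>
    intro x hx h0 h1
    have hf : ⌊x⌋ = 0 := by rw [Int.floor_eq_zero_iff]; exact ⟨h0.le, h1⟩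
    have hfr : Int.fract x = x := by rw [Int.fract, hf]; simp
    obtain ⟨a, b, c⟩ := gauss_irr hx h0 h1
    obtain ⟨e1, e2⟩ := (cfPQ_shift x n).2
    have hq : (0 : ℚ) < cfQ (Int.fract (1 / x)) (n + 1) := by
      exact_mod_cast (cfQ_pos a b c n).2
    rw [Real.convergent_succ, hf, hfr, convergent_fract, ← one_div x, ih a b c, e1, e2]
    push_cast
    rw [← inv_div, zero_add]
    field_simp

/-- Legendre's theorem in terms of `cfP`, `cfQ`. -/
lemma legendre_cf {x : ℝ} (hx : Irrational x) (h0 : 0 < x) (h1 : x < 1) (P Q : ℤ) (hQ : 0 < Q)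
    (hc : IsCoprime P Q) (h : |(Q : ℝ) * x - P| * Q < 1 / 2) :
    ∃ j, vconv x j = ![-P, Q] := by
  have hcop : P.natAbs.Coprime Q.natAbs := Int.isCoprime_iff_gcd_eq_one.mp hc
  have hnum : ((P : ℚ) / Q).num = P := Rat.num_div_eq_of_coprime hQ hcop
  have hden : (((P : ℚ) / Q).den : ℤ) = Q := Rat.den_div_eq_of_coprime hQ hcop
  have hQr : (0 : ℝ) < Q := by exact_mod_cast hQ
  have hden' : (((P : ℚ) / Q).den : ℝ) = Q := by exact_mod_cast hden
  obtain ⟨n, hn⟩ := Real.exists_rat_eq_convergent (ξ := x) (q := (P : ℚ) / Q) (by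
    rw [hden']
    push_cast
    have e : x - P / Q = (Q * x - P) / Q := by field_simp
    rw [e, abs_div, abs_of_pos hQr, div_lt_div_iff₀ hQr (by positivity)]
    nlinarith)
  refine ⟨n, ?_⟩
  rw [convergent_eq n hx h0 h1] at hn
  have hq := (cfQ_pos hx h0 h1 n).2
  have hcop2 : (cfP x (n + 1)).natAbs.Coprime (cfQ x (n + 1)).natAbs :=
    Int.isCoprime_iff_gcd_eq_one.mp (cfPQ_coprime x _)
  have hnum2 := Rat.num_div_eq_of_coprime hq hcop2
  have hden2 := Rat.den_div_eq_of_coprime hq hcop2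
  rw [← hn] at hnum2 hden2
  rw [vconv, ← hnum2, ← hden2, hnum, hden]

/-- Integer binary forms with minimum `M`: `5 M² ≤ D`. -/
lemma form_reduced (A B C : ℤ) (M : ℤ) (hM : 0 < M) (hA : A = M) (hB0 : 0 ≤ B) (hB : B ≤ M)
    (hD : 0 < B ^ 2 - 4 * A * C) (hC : M ≤ |C|) (hS : M ≤ |A + B + C|) :
    5 * M ^ 2 ≤ B ^ 2 - 4 * A * C := by
  subst hA
  have hCneg : C ≤ -A := by
    rcases le_abs.mp hC with h | h
    · nlinarith
    · linarith
  rcases le_abs.mp hS with h | h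
  · have : C = -A := by linarith
    have : B = A := by linarith
    subst this; nlinarith
  · nlinarith

lemma form_min (α β γ : ℤ) (M : ℤ) (hM : 0 < M) (x y : ℤ)
    (hxy : |α * x ^ 2 + β * x * y + γ * y ^ 2| = M)
    (hmin : ∀ u v : ℤ, (u ≠ 0 ∨ v ≠ 0) → M ≤ |α * u ^ 2 + β * u * v + γ * v ^ 2|)
    (hD : 0 < β ^ 2 - 4 * α * γ) : 5 * M ^ 2 ≤ β ^ 2 - 4 * α * γ := by
  -- sign normalisation
  wlog hs : 0 < α * x ^ 2 + β * x * y + γ * y ^ 2 generalizing α β γ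
  · have := this (-α) (-β) (-γ)
      (by rw [← hxy, ← abs_neg]; congr 1; ring)
      (fun u v h => by
        have := hmin u v h
        rw [← abs_neg] at this
        convert this using 2; ring)
      (by linarith)
      (by
        have : α * x ^ 2 + β * x * y + γ * y ^ 2 ≠ 0 := by
          intro h; rw [h] at hxy; simp at hxy; omega
        have : α * x ^ 2 + β * x * y + γ * y ^ 2 < 0 := by omega
        linarith)
    linarith
  rw [abs_of_pos hs] at hxy
  -- coprimality
  have hne : x ≠ 0 ∨ y ≠ 0 := by
    by_contra h; push Not at h
    rw [h.1, h.2] at hs; simp at hs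
  have hcop : IsCoprime x y := by
    rw [Int.isCoprime_iff_gcd_eq_one]
    obtain ⟨u, hu⟩ := Int.gcd_dvd_left x y
    obtain ⟨v, hv⟩ := Int.gcd_dvd_right x y
    have hg0 : 0 < Int.gcd x y := Int.gcd_pos_iff.mpr hne
    generalize Int.gcd x y = g at *
    have huv : u ≠ 0 ∨ v ≠ 0 := by
      by_contra h; push Not at h
      rw [h.1] at hu; rw [h.2] at hv; simp at hu hv; tauto
    have h1 := hmin u v huv
    have e : M = (g : ℤ) ^ 2 * (α * u ^ 2 + β * u * v + γ * v ^ 2) := by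
      rw [← hxy, hu, hv]; ring
    have e2 : M = (g : ℤ) ^ 2 * |α * u ^ 2 + β * u * v + γ * v ^ 2| := by
      rw [← abs_of_pos hM, e, abs_mul, abs_of_nonneg (sq_nonneg (g : ℤ))]
    by_contra hg1
    have h2 : (2 : ℤ) ≤ g := by omega
    have h4 : (4 : ℤ) ≤ (g : ℤ) ^ 2 := by nlinarith
    have := mul_le_mul_of_nonneg_right h4 (abs_nonneg (α * u ^ 2 + β * u * v + γ * v ^ 2))
    linarith
  obtain ⟨r, s, hrs⟩ := hcop
  -- second basis vector (-s, r) + t (x, y), possibly negated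
  have key : ∀ u v : ℤ, (x * v - y * u) ^ 2 = 1 →
      0 ≤ 2 * α * x * u + β * (x * v + y * u) + 2 * γ * y * v →
      2 * α * x * u + β * (x * v + y * u) + 2 * γ * y * v ≤ M →
      5 * M ^ 2 ≤ β ^ 2 - 4 * α * γ := by
    intro u v hdet hB0 hB
    have hDD : (2 * α * x * u + β * (x * v + y * u) + 2 * γ * y * v) ^ 2 -
        4 * (α * x ^ 2 + β * x * y + γ * y ^ 2) * (α * u ^ 2 + β * u * v + γ * v ^ 2)
        = β ^ 2 - 4 * α * γ := by
      linear_combination (β ^ 2 - 4 * α * γ) * hdet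
    have h := form_reduced (α * x ^ 2 + β * x * y + γ * y ^ 2)
      (2 * α * x * u + β * (x * v + y * u) + 2 * γ * y * v)
      (α * u ^ 2 + β * u * v + γ * v ^ 2) M hM hxy hB0 hB (by rw [hDD]; exact hD)
      (hmin u v (by
        by_contra h; push Not at h
        rw [h.1, h.2] at hdet; simp at hdet))
      (by
        have := hmin (x + u) (y + v) (by
          by_contra h; push Not at h
          have h1 : u = -x := by linarith [h.1]
          have h2 : v = -y := by linarith [h.2]
          rw [h1, h2] at hdet; ring_nf at hdet; simp at hdet)
        convert this using 2; ring)
    rw [hDD] at h; exact h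
  set B0 := 2 * α * x * (-s) + β * (x * r + y * (-s)) + 2 * γ * y * r with hB0
  have hm0 := Int.emod_nonneg B0 (show (2 * M) ≠ 0 by omega)
  have hm1 := Int.emod_lt_of_pos B0 (show 0 < (2 * M) by omega)
  have hm2 := Int.emod_add_mul_ediv B0 (2 * M)
  set t := B0 / (2 * M)
  set R := B0 % (2 * M)
  by_cases hR : R ≤ M
  · have e : 2 * α * x * (-s - t * x) + β * (x * (r - t * y) + y * (-s - t * x))
        + 2 * γ * y * (r - t * y) = R := by
      linear_combination -hm2 - 2 * t * hxy + hB0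
    apply key (-s - t * x) (r - t * y)
    · linear_combination (r * x + s * y + 1) * hrs
    · rw [e]; exact hm0
    · rw [e]; exact hR
  · have e : 2 * α * x * (s + (t + 1) * x) + β * (x * (-r + (t + 1) * y) + y * (s + (t + 1) * x))
        + 2 * γ * y * (-r + (t + 1) * y) = 2 * M - R := by
      linear_combination hm2 + 2 * (t + 1) * hxy - hB0
    apply key (s + (t + 1) * x) (-r + (t + 1) * y)
    · linear_combination (r * x + s * y + 1) * hrs
    · rw [e]; omega
    · rw [e]; omega

lemma cfMatProd_succ (Ω : ℝ) (m : ℕ) :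
    cfMatProd Ω (m + 1) = cfMatProd Ω m * Acf (cfA Ω m) := by
  simp [cfMatProd, List.range_succ]

lemma cfMatProd_det (Ω : ℝ) (m : ℕ) : (cfMatProd Ω m).det = (-1) ^ m := by
  induction m with
  | zero => simp [cfMatProd]
  | succ m ih => rw [cfMatProd_succ, Matrix.det_mul, ih, pow_succ]; simp [Acf, Matrix.det_fin_two]

lemma cfMatProd_nonneg {Ω : ℝ} (hx : Irrational Ω) (h0 : 0 < Ω) (h1 : Ω < 1) (m : ℕ) :
    ∀ i j, 0 ≤ cfMatProd Ω m i j := by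
  induction m with
  | zero =>
    intro i j
    fin_cases i <;> fin_cases j <;> simp [cfMatProd]
  | succ m ih =>
    intro i j
    rw [cfMatProd_succ, Matrix.mul_apply]
    refine Finset.sum_nonneg fun k _ => mul_nonneg (ih i k) ?_
    have := cfA_pos hx h0 h1 m
    fin_cases k <;> fin_cases j <;> simp [Acf]
    omega

lemma Umat_eq (Ω : ℝ) (m : ℕ) :
    Umat Ω m = !![cfMatProd Ω m 1 1, -cfMatProd Ω m 1 0; -cfMatProd Ω m 0 1, cfMatProd Ω m 0 0] := by
  have h2 : ((-1 : ℤ) ^ m) * (-1) ^ m = 1 := by rw [← mul_pow]; simp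
  have hi : (cfMatProd Ω m)⁻¹ = ((-1 : ℤ) ^ m) • (cfMatProd Ω m).adjugate := by
    apply Matrix.inv_eq_right_inv
    rw [Matrix.mul_smul, Matrix.mul_adjugate, cfMatProd_det, smul_smul, h2, one_smul]
  rw [Umat, hi, Matrix.transpose_smul, smul_smul, h2, one_smul, Matrix.adjugate_fin_two]
  ext i j
  fin_cases i <;> fin_cases j <;> rfl

/-- The data used in the proof. -/
structure QDat (Ω : ℝ) (a b c d : ℤ) (lam : ℝ) : Prop where
  irr : Irrational Ω
  pos : 0 < Ω
  lt1 : Ω < 1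
  b0 : 0 ≤ b
  c0 : 0 ≤ c
  det : a * d - b * c = 1 ∨ a * d - b * c = -1
  lam1 : 1 < lam
  e1 : (a : ℝ) + b * Ω = lam
  e2 : (c : ℝ) + d * Ω = lam * Ω

/-- The matrix `U`. -/
def UU (a b c d : ℤ) : Matrix (Fin 2) (Fin 2) ℤ := !![d, -c; -b, a]

/-- Conjugate linear form. -/
def Lc (Ω : ℝ) (a b d : ℤ) (k : Fin 2 → ℤ) : ℝ := b * Ω * k 1 + (a - d) * k 1 - b * k 0

/-- The integral quadratic form. -/
def ff (a b c d : ℤ) (k : Fin 2 → ℤ) : ℤ := c * k 1 ^ 2 + (a - d) * k 0 * k 1 - b * k 0 ^ 2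

lemma irr_lin {Ω : ℝ} (h : Irrational Ω) (x y : ℤ) (e : (x : ℝ) + y * Ω = 0) : x = 0 ∧ y = 0 := by
  have hy : y = 0 := by
    by_contra hy
    have hy' : (y : ℝ) ≠ 0 := by exact_mod_cast hy
    apply h
    refine ⟨-x / y, ?_⟩
    push_cast
    field_simp
    linarith
  subst hy
  simp at e
  exact ⟨e, rfl⟩

namespace QDat

variable {Ω : ℝ} {a b c d : ℤ} {lam : ℝ}

lemma quad (H : QDat Ω a b c d lam) : (b : ℝ) * Ω ^ 2 + (a - d) * Ω - c = 0 := by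
  linear_combination Ω * H.e1 - H.e2

lemma b_pos (H : QDat Ω a b c d lam) : 0 < b := by
  refine lt_of_le_of_ne H.b0 fun hb => ?_
  have hb := hb.symm
  have hq := H.quad
  have e1 := H.e1
  have hdet := H.det
  subst hb
  obtain ⟨h1, h2⟩ := irr_lin H.irr (-c) (a - d) (by push_cast at *; linarith)
  have : d = a := by linarith
  subst this
  have hl := H.lam1
  push_cast at e1
  have : (1 : ℝ) < d := by linarith
  have : (1 : ℤ) < d := by exact_mod_cast this
  rcases hdet with h | h <;> nlinarith

lemma c_pos (H : QDat Ω a b c d lam) : 0 < c := by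
  refine lt_of_le_of_ne H.c0 fun hc => ?_
  have hc := hc.symm
  have hq := H.quad
  subst hc
  have hp := H.pos
  obtain ⟨h1, h2⟩ := irr_lin H.irr (a - d) b (by
    have : Ω * (((a - d : ℤ) : ℝ) + b * Ω) = 0 := by push_cast at *; linarith
    exact (mul_eq_zero.mp this).resolve_left hp.ne')
  exact H.b_pos.ne' h2

lemma mu (H : QDat Ω a b c d lam) : lam * (d - b * Ω) = ((a * d - b * c : ℤ) : ℝ) := by
  have := H.quad
  push_cast
  linear_combination (-(d - b * Ω)) * H.e1 - b * this

lemma abs_mu (H : QDat Ω a b c d lam) : |(d : ℝ) - b * Ω| = lam⁻¹ := by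
  have hl : 0 < lam := by linarith [H.lam1]
  have : |lam * ((d : ℝ) - b * Ω)| = 1 := by
    rw [H.mu]
    rcases H.det with h | h <;> rw [h] <;> simp
  rw [abs_mul, abs_of_pos hl] at this
  field_simp
  linarith

lemma delta_pos (H : QDat Ω a b c d lam) : 0 < 2 * b * Ω + a - d := by
  have h := H.abs_mu
  have h1 : lam⁻¹ < 1 := inv_lt_one_of_one_lt₀ H.lam1
  have := le_abs_self ((d : ℝ) - b * Ω)
  linarith [H.e1, H.lam1]

lemma delta_sq (H : QDat Ω a b c d lam) :
    (2 * b * Ω + a - d) ^ 2 = (((a - d) ^ 2 + 4 * b * c : ℤ) : ℝ) := by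
  push_cast
  linear_combination 4 * b * H.quad

lemma ff_eq (H : QDat Ω a b c d lam) (k : Fin 2 → ℤ) :
    (ff a b c d k : ℝ) = pairω Ω k * Lc Ω a b d k := by
  simp only [ff, pairω, Lc]
  push_cast
  linear_combination (-(k 1 : ℝ) ^ 2) * H.quad

lemma Lc_eq (k : Fin 2 → ℤ) :
    Lc Ω a b d k = (2 * b * Ω + a - d) * k 1 - b * pairω Ω k := by
  simp only [pairω, Lc]; ring

lemma pair_U (H : QDat Ω a b c d lam) (k : Fin 2 → ℤ) :
    pairω Ω ((UU a b c d).mulVec k) = (d - b * Ω) * pairω Ω k := by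
  simp [pairω, UU, Matrix.mulVec, dotProduct, Fin.sum_univ_two]
  linear_combination (k 1 : ℝ) * H.quad

lemma Lc_U (H : QDat Ω a b c d lam) (k : Fin 2 → ℤ) :
    Lc Ω a b d ((UU a b c d).mulVec k) = lam * Lc Ω a b d k := by
  simp [Lc, UU, Matrix.mulVec, dotProduct, Fin.sum_univ_two]
  rw [← H.e1]
  linear_combination (-(b * k 1 : ℝ)) * H.quad

lemma ff_U (k : Fin 2 → ℤ) :
    ff a b c d ((UU a b c d).mulVec k) = (a * d - b * c) * ff a b c d k := by
  simp [ff, UU, Matrix.mulVec, dotProduct, Fin.sum_univ_two]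
  ring

lemma abs_ff_U (H : QDat Ω a b c d lam) (k : Fin 2 → ℤ) :
    |ff a b c d ((UU a b c d).mulVec k)| = |ff a b c d k| := by
  rw [ff_U, abs_mul]
  rcases H.det with h | h <;> rw [h] <;> simp

lemma pair_ne (H : QDat Ω a b c d lam) (k : Fin 2 → ℤ) (hk : k 0 ≠ 0 ∨ k 1 ≠ 0) :
    pairω Ω k ≠ 0 := by
  intro h
  have := irr_lin H.irr _ _ h
  tauto

lemma Lc_ne (H : QDat Ω a b c d lam) (k : Fin 2 → ℤ) (hk : k 0 ≠ 0 ∨ k 1 ≠ 0) :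
    Lc Ω a b d k ≠ 0 := by
  intro h
  have hb := H.b_pos
  obtain ⟨h1, h2⟩ := irr_lin H.irr ((a - d) * k 1 - b * k 0) (b * k 1) (by
    rw [← h, Lc]; push_cast; ring)
  have h3 : k 1 = 0 := (mul_eq_zero.mp h2).resolve_left hb.ne'
  rw [h3] at h1
  have h4 : k 0 = 0 := by
    have : b * k 0 = 0 := by linarith
    exact (mul_eq_zero.mp this).resolve_left hb.ne'
  tauto

lemma ff_ne (H : QDat Ω a b c d lam) (k : Fin 2 → ℤ) (hk : k 0 ≠ 0 ∨ k 1 ≠ 0) :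
    ff a b c d k ≠ 0 := by
  have : (ff a b c d k : ℝ) ≠ 0 := by
    rw [H.ff_eq]; exact mul_ne_zero (H.pair_ne k hk) (H.Lc_ne k hk)
  exact_mod_cast this

lemma inA_iff (k : Fin 2 → ℤ) : inA Ω k ↔ 1 ≤ k 1 ∧ |pairω Ω k| < 1 / 2 := by
  constructor
  · rintro ⟨q, hq, e, h⟩
    refine ⟨?_, h⟩
    rw [e]; simpa [kzero] using hq
  · rintro ⟨h1, h2⟩
    refine ⟨k 1, h1, ?_, h2⟩
    have : p0 Ω (k 1) = -k 0 := by
      rw [p0, round_eq, Int.floor_eq_iff]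
      rw [pairω, abs_lt] at h2
      push_cast
      constructor <;> linarith [h2.1, h2.2]
    ext i
    fin_cases i <;> simp [kzero, this]

lemma pow_facts (H : QDat Ω a b c d lam) (k : Fin 2 → ℤ) (n : ℕ) :
    |pairω Ω ((UU a b c d ^ n).mulVec k)| = lam⁻¹ ^ n * |pairω Ω k| ∧
    Lc Ω a b d ((UU a b c d ^ n).mulVec k) = lam ^ n * Lc Ω a b d k ∧
    |ff a b c d ((UU a b c d ^ n).mulVec k)| = |ff a b c d k| := by
  induction n with
  | zero => simp
  | succ n ih =>
    obtain ⟨i1, i2, i3⟩ := ih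
    rw [pow_succ' (UU a b c d), ← Matrix.mulVec_mulVec]
    refine ⟨?_, ?_, ?_⟩
    · rw [H.pair_U, abs_mul, H.abs_mu, i1]; ring
    · rw [H.Lc_U, i2]; ring
    · rw [H.abs_ff_U, i3]

lemma eventually_good (H : QDat Ω a b c d lam) (k : Fin 2 → ℤ) (hk : 0 < Lc Ω a b d k)
    (η : ℝ) (hη : 0 < η) :
    ∃ n : ℕ, 1 ≤ ((UU a b c d ^ n).mulVec k) 1 ∧ |pairω Ω ((UU a b c d ^ n).mulVec k)| < η := by
  have hl0 : 0 < lam := by linarith [H.lam1]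
  have t1 : Tendsto (fun n : ℕ => lam⁻¹ ^ n * |pairω Ω k|) atTop (nhds (0 * |pairω Ω k|)) :=
    (tendsto_pow_atTop_nhds_zero_of_lt_one (by positivity)
      (inv_lt_one_of_one_lt₀ H.lam1)).mul_const _
  rw [zero_mul] at t1
  have t2 : Tendsto (fun n : ℕ => lam ^ n * Lc Ω a b d k) atTop atTop :=
    (tendsto_pow_atTop_atTop_of_one_lt H.lam1).atTop_mul_const hk
  have ev := (t1.eventually_lt_const (lt_min hη one_pos)).and (t2.eventually_gt_atTop (b : ℝ))
  obtain ⟨n, h1, h2⟩ := ev.exists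
  obtain ⟨i1, i2, -⟩ := H.pow_facts k n
  refine ⟨n, ?_, ?_⟩
  · rw [← i1] at h1
    rw [← i2, Lc_eq] at h2
    have h3 := (abs_lt.mp (h1.trans_le (min_le_right _ _))).1
    have hb : (0 : ℝ) < b := by exact_mod_cast H.b_pos
    have h4 : 0 < (2 * b * Ω + a - d) * (((UU a b c d ^ n).mulVec k) 1 : ℝ) := by nlinarith
    have h5 := (mul_pos_iff_of_pos_left H.delta_pos).mp h4
    have h6 : 0 < ((UU a b c d ^ n).mulVec k) 1 := by exact_mod_cast h5
    omega
  · rw [i1]; exact h1.trans_le (min_le_left _ _)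

lemma U_inv (H : QDat Ω a b c d lam) (k : Fin 2 → ℤ) :
    (UU a b c d).mulVec ((UU a b c d)⁻¹.mulVec k) = k := by
  rw [Matrix.mulVec_mulVec, Matrix.mul_nonsing_inv, Matrix.one_mulVec]
  rw [Int.isUnit_iff, UU, Matrix.det_fin_two_of]
  rcases H.det with h | h
  · left; linarith
  · right; linarith

lemma exists_prim (H : QDat Ω a b c d lam) (k : Fin 2 → ℤ) (hk : inA Ω k) :
    ∃ q', PrimitiveInt Ω (UU a b c d) q' ∧ |ff a b c d (kzero Ω q')| = |ff a b c d k| := by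
  by_contra hcon
  push Not at hcon
  have key : ∀ n : ℕ, ∃ k', inA Ω k' ∧ |ff a b c d k'| = |ff a b c d k| ∧
      |pairω Ω k'| = lam ^ n * |pairω Ω k| := by
    intro n
    induction n with
    | zero => exact ⟨k, hk, rfl, by simp⟩
    | succ n ih =>
      obtain ⟨k', h1, h2, h3⟩ := ih
      obtain ⟨q', hq', e, hh⟩ := h1
      have hin : inA Ω ((UU a b c d)⁻¹.mulVec k') := by
        by_contra hni
        refine hcon q' ⟨hq', ?_⟩ (by rw [← e]; exact h2)
        rw [← e]
        exact ⟨⟨q', hq', e, hh⟩, hni⟩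
      refine ⟨_, hin, ?_, ?_⟩
      · rw [← h2, ← H.abs_ff_U, H.U_inv]
      · have hp := H.pair_U ((UU a b c d)⁻¹.mulVec k')
        rw [H.U_inv] at hp
        have hp2 := congrArg abs hp
        rw [abs_mul, H.abs_mu, h3] at hp2
        have hl0 : 0 < lam := by linarith [H.lam1]
        field_simp at hp2
        rw [← hp2]; ring
  have hk1 := ((inA_iff k).mp hk).1
  have hne : 0 < |pairω Ω k| := abs_pos.mpr (H.pair_ne k (by right; omega))
  have t2 : Tendsto (fun n : ℕ => lam ^ n * |pairω Ω k|) atTop atTop :=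
    (tendsto_pow_atTop_atTop_of_one_lt H.lam1).atTop_mul_const hne
  obtain ⟨n, hn⟩ := (t2.eventually_gt_atTop (1 / 2 : ℝ)).exists
  obtain ⟨k', h1, h2, h3⟩ := key n
  have := ((inA_iff k').mp h1).2
  linarith

lemma exists_prim' (H : QDat Ω a b c d lam) (k : Fin 2 → ℤ) (hk : k 0 ≠ 0 ∨ k 1 ≠ 0) :
    ∃ q', PrimitiveInt Ω (UU a b c d) q' ∧ |ff a b c d (kzero Ω q')| = |ff a b c d k| := by
  have main : ∀ k : Fin 2 → ℤ, 0 < Lc Ω a b d k →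
      ∃ q', PrimitiveInt Ω (UU a b c d) q' ∧ |ff a b c d (kzero Ω q')| = |ff a b c d k| := by
    intro k hk
    obtain ⟨n, h1, h2⟩ := H.eventually_good k hk (1 / 2) (by norm_num)
    obtain ⟨q', h3, h4⟩ := H.exists_prim _ ((inA_iff _).mpr ⟨h1, h2⟩)
    exact ⟨q', h3, by rw [h4, (H.pow_facts k n).2.2]⟩
  rcases lt_or_gt_of_ne (H.Lc_ne k hk) with h | h
  · obtain ⟨q', h1, h2⟩ := main (-k) (by
      have : Lc Ω a b d (-k) = -Lc Ω a b d k := by simp [Lc]; ring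
      rw [this]; linarith)
    refine ⟨q', h1, ?_⟩
    rw [h2]; congr 1; simp [ff]
  · exact main k h

lemma Lc_kzero_pos (H : QDat Ω a b c d lam) (q : ℤ) (hq : 1 ≤ q) :
    0 < Lc Ω a b d (kzero Ω q) := by
  have hp : 0 ≤ p0 Ω q := by
    rw [p0, round_eq]
    apply Int.floor_nonneg.mpr
    have : (0 : ℝ) ≤ q := by exact_mod_cast (by omega : 0 ≤ q)
    have := H.pos
    positivity
  have hc := H.c_pos
  have hb := H.b_pos
  have hO := H.pos
  have : 0 < Ω * Lc Ω a b d (kzero Ω q) := by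
    have e : Ω * Lc Ω a b d (kzero Ω q) = c * q + b * p0 Ω q * Ω := by
      simp [Lc, kzero]
      linear_combination q * H.quad
    rw [e]
    have h1 : (0 : ℝ) < c * q := by exact_mod_cast mul_pos hc (by omega : 0 < q)
    have h2 : (0 : ℝ) ≤ b * p0 Ω q := by exact_mod_cast mul_nonneg hb.le hp
    nlinarith [mul_nonneg h2 hO.le]
  exact (mul_pos_iff_of_pos_left hO).mp this

lemma core (H : QDat Ω a b c d lam) (qh : ℤ) (hqh : PrimitiveInt Ω (UU a b c d) qh)
    (hmin : ∀ q', PrimitiveInt Ω (UU a b c d) q' →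
      |ff a b c d (kzero Ω qh)| ≤ |ff a b c d (kzero Ω q')|)
    (q : ℤ) (hq : PrimitiveInt Ω (UU a b c d) q)
    (hnc : ∀ n j : ℕ, sres Ω (UU a b c d) q n ≠ vconv Ω j) :
    0 < |ff a b c d (kzero Ω qh)| ∧
    √5 / 2 * ((|ff a b c d (kzero Ω qh)| : ℤ) : ℝ) < ((|ff a b c d (kzero Ω q)| : ℤ) : ℝ) := by
  have hne : ∀ q : ℤ, 1 ≤ q → ff a b c d (kzero Ω q) ≠ 0 := fun q hq =>
    H.ff_ne _ (by right; simp [kzero]; omega)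
  have hMpos : 0 < |ff a b c d (kzero Ω qh)| := abs_pos.mpr (hne _ hqh.1)
  set M := |ff a b c d (kzero Ω qh)| with hM
  have hall : ∀ k : Fin 2 → ℤ, (k 0 ≠ 0 ∨ k 1 ≠ 0) → M ≤ |ff a b c d k| := by
    intro k hk
    obtain ⟨q', h1, h2⟩ := H.exists_prim' k hk
    rw [← h2]; exact hmin q' h1
  have hb := H.b_pos
  have hδ := H.delta_pos
  have hδsq := H.delta_sq
  set δ : ℝ := 2 * b * Ω + a - d with hδdef
  have hD : 0 < (a - d) ^ 2 + 4 * b * c := by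
    have : (0 : ℝ) < (((a - d) ^ 2 + 4 * b * c : ℤ) : ℝ) := by rw [← hδsq]; positivity
    exact_mod_cast this
  -- Hurwitz
  have hH : 5 * M ^ 2 ≤ (a - d) ^ 2 + 4 * b * c := by
    have := form_min (-b) (a - d) c M hMpos (kzero Ω qh 0) (kzero Ω qh 1)
      (by rw [hM, ff]; congr 1; ring)
      (fun u v huv => by
        have := hall ![u, v] (by simpa using huv)
        simp only [ff, Matrix.cons_val_zero, Matrix.cons_val_one] at this
        convert this using 2; ring)
      (by linarith)
    linarith
  have hMr : (0 : ℝ) < M := by exact_mod_cast hMpos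
  have hH' : √5 * M ≤ δ := by
    have h5 : 5 * (M : ℝ) ^ 2 ≤ δ ^ 2 := by rw [hδsq]; exact_mod_cast hH
    have : (√5 * M) ^ 2 ≤ δ ^ 2 := by
      rw [mul_pow, Real.sq_sqrt (by norm_num)]; exact h5
    exact (pow_le_pow_iff_left₀ (by positivity) hδ.le (by norm_num)).mp this
  refine ⟨hMpos, ?_⟩
  set F := |ff a b c d (kzero Ω q)| with hF
  rcases lt_trichotomy (F : ℝ) (δ / 2) with hlt | heq | hgt
  · -- Legendre
    set η : ℝ := min 1 ((δ / 2 - F) / b) with hη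
    have hbr : (0 : ℝ) < b := by exact_mod_cast hb
    have hηpos : 0 < η := lt_min one_pos (div_pos (by linarith) hbr)
    obtain ⟨n, h1, h2⟩ := H.eventually_good (kzero Ω q) (H.Lc_kzero_pos q hq.1) η hηpos
    have hfk : |ff a b c d ((UU a b c d ^ n).mulVec (kzero Ω q))| = F :=
      (H.pow_facts (kzero Ω q) n).2.2
    have hnc' := hnc n
    rw [sres] at hnc'
    set k := (UU a b c d ^ n).mulVec (kzero Ω q) with hk
    have hk1 : (1 : ℝ) ≤ k 1 := by exact_mod_cast h1
    have hfr : |pairω Ω k| * |Lc Ω a b d k| = F := by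
      rw [← abs_mul, ← H.ff_eq, ← hfk]; push_cast; rfl
    have hsmall : |pairω Ω k| * k 1 < 1 / 2 := by
      have e1 : δ * k 1 ≤ |Lc Ω a b d k| + b * |pairω Ω k| := by
        have e := Lc_eq (Ω := Ω) (a := a) (b := b) (d := d) k
        rw [← hδdef] at e
        have := le_abs_self (Lc Ω a b d k)
        have := mul_le_mul_of_nonneg_left (le_abs_self (pairω Ω k)) hbr.le
        linarith
      have e2 := mul_le_mul_of_nonneg_left e1 (abs_nonneg (pairω Ω k))
      have e3 : |pairω Ω k| < 1 := h2.trans_le (min_le_left _ _)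
      have e4 : b * |pairω Ω k| < δ / 2 - F := by
        have := h2.trans_le (min_le_right _ _)
        rw [lt_div_iff₀ hbr] at this
        linarith
      have e5 : |pairω Ω k| * (b * |pairω Ω k|) ≤ b * |pairω Ω k| := by
        have := abs_nonneg (pairω Ω k)
        have := mul_nonneg hbr.le this
        nlinarith
      have e6 : δ * (|pairω Ω k| * k 1) < δ * (1 / 2) := by nlinarith
      exact lt_of_mul_lt_mul_left e6 hδ.le
    -- reduce to coprime
    obtain ⟨u, hu⟩ := Int.gcd_dvd_left (k 0) (k 1)
    obtain ⟨v, hv⟩ := Int.gcd_dvd_right (k 0) (k 1)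
    have hg0 : 0 < Int.gcd (k 0) (k 1) := Int.gcd_pos_iff.mpr (by right; omega)
    have hcop : IsCoprime u v := by
      have hgz : (Int.gcd (k 0) (k 1) : ℤ) ≠ 0 := by omega
      have hbz := Int.gcd_eq_gcd_ab (k 0) (k 1)
      refine ⟨Int.gcdA (k 0) (k 1), Int.gcdB (k 0) (k 1), ?_⟩
      apply mul_left_cancel₀ hgz
      linear_combination -hbz - Int.gcdA (k 0) (k 1) * hu - Int.gcdB (k 0) (k 1) * hv
    generalize Int.gcd (k 0) (k 1) = g at hu hv hg0
    have hgz : (0 : ℤ) < g := by exact_mod_cast hg0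
    have hv0 : 0 < v := by
      have : 0 < (g : ℤ) * v := by rw [← hv]; omega
      exact (mul_pos_iff_of_pos_left hgz).mp this
    have hpv : pairω Ω k = g * (v * Ω - ((-u : ℤ) : ℝ)) := by
      rw [pairω, hu, hv]; push_cast; ring
    have hg1r : (1 : ℝ) ≤ g := by exact_mod_cast hg0
    have hvr : (0 : ℝ) < v := by exact_mod_cast hv0
    obtain ⟨j, hj⟩ := legendre_cf H.irr H.pos H.lt1 (-u) v hv0 hcop.neg_left (by
      have e : |pairω Ω k| * k 1 = (g : ℝ) ^ 2 * (|v * Ω - ((-u : ℤ) : ℝ)| * v) := by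
        rw [hpv, hv, abs_mul, abs_of_nonneg (by positivity : (0 : ℝ) ≤ g)]; push_cast; ring
      rw [e] at hsmall
      have h0 : 0 ≤ |v * Ω - ((-u : ℤ) : ℝ)| * v := by positivity
      have : (1 : ℝ) ≤ (g : ℝ) ^ 2 := one_le_pow₀ hg1r
      nlinarith)
    have hg2 : (2 : ℤ) ≤ g := by
      by_contra hg
      have hg : (g : ℤ) = 1 := by omega
      rw [hg, one_mul] at hu hv
      apply hnc' j
      rw [hj]
      ext i
      fin_cases i
      · simp [hu]
      · simp [hv]
    have hge : M ≤ |ff a b c d ![u, v]| := hall _ (by right; simp; omega)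
    have hff : ff a b c d k = (g : ℤ) ^ 2 * ff a b c d ![u, v] := by
      simp only [ff, Matrix.cons_val_zero, Matrix.cons_val_one]
      rw [hu, hv]; ring
    have h4 : 4 * M ≤ F := by
      rw [← hfk, hff, abs_mul, abs_of_nonneg (by positivity : (0 : ℤ) ≤ (g : ℤ) ^ 2)]
      have : (4 : ℤ) ≤ (g : ℤ) ^ 2 := by nlinarith
      exact mul_le_mul this hge hMpos.le (by positivity)
    have h4r : 4 * (M : ℝ) ≤ F := by exact_mod_cast h4
    have h5 : √5 < 3 := by
      rw [Real.sqrt_lt' (by norm_num)]; norm_num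
    nlinarith
  · exfalso
    obtain ⟨-, h⟩ := irr_lin H.irr (a - d - 2 * F) (2 * b) (by push_cast; linarith)
    omega
  · linarith

end QDat

/-- Lemma 4: for any primitive `q` whose resonant sequence `s(q,n)` contains no
resonant convergent, the normalized limit numerator satisfies `γ̃*_q > √5/2`. -/
theorem splitting_quadratic_stmt11
    (Ω : ℝ) (m : ℕ) (hm : 1 ≤ m) (h0 : 0 < Ω) (h1 : Ω < 1)
    (hquad : IsQuadraticIrrational Ω)
    (hper : gaussOrbit Ω m = Ω)
    (lam : ℝ) (hlam : 1 < lam)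
    (heig : ((cfMatProd Ω m).map fun z : ℤ => (z : ℝ)).mulVec ![1, Ω] = lam • ![1, Ω])
    (qh : ℤ) (hqh : PrimitiveInt Ω (Umat Ω m) qh)
    (hmin : ∀ q' : ℤ, PrimitiveInt Ω (Umat Ω m) q' →
      gammaStarQ Ω m qh ≤ gammaStarQ Ω m q')
    (q : ℤ) (hq : PrimitiveInt Ω (Umat Ω m) q)
    (hnc : ∀ (n : ℕ) (j : ℕ), sres Ω (Umat Ω m) q n ≠ vconv Ω j) :
    Real.sqrt 5 / 2 < gammaStarQ Ω m q / gammaStarQ Ω m qh := by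
  have hirr := hquad.1
  have hT := cfMatProd_nonneg hirr h0 h1 m
  have hdet := cfMatProd_det Ω m
  rw [Matrix.det_fin_two] at hdet
  have hg := Umat_eq Ω m
  have e1 := congrFun heig 0
  have e2 := congrFun heig 1
  simp [Matrix.mulVec, dotProduct, Fin.sum_univ_two] at e1 e2
  have H : QDat Ω (cfMatProd Ω m 0 0) (cfMatProd Ω m 0 1) (cfMatProd Ω m 1 0)
      (cfMatProd Ω m 1 1) lam :=
    { irr := hirr, pos := h0, lt1 := h1, b0 := hT 0 1, c0 := hT 1 0
      det := by
        rw [hdet]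
        exact neg_one_pow_eq_or ℤ m
      lam1 := hlam, e1 := e1, e2 := e2 }
  have hU : Umat Ω m = UU (cfMatProd Ω m 0 0) (cfMatProd Ω m 0 1) (cfMatProd Ω m 1 0)
      (cfMatProd Ω m 1 1) := hg
  rw [hU] at hqh hmin hq hnc
  have hγ : ∀ q : ℤ, gammaStarQ Ω m q =
      ((|ff (cfMatProd Ω m 0 0) (cfMatProd Ω m 0 1) (cfMatProd Ω m 1 0)
      (cfMatProd Ω m 1 1) (kzero Ω q)| : ℤ) : ℝ) * ((1 + Ω) / (2 * (cfMatProd Ω m 0 1) * Ω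
        + (cfMatProd Ω m 0 0) - (cfMatProd Ω m 1 1))) := by
    intro q
    have hδ := H.delta_pos
    have hquad' := H.quad
    rw [gammaStarQ, KqD]
    push_cast
    rw [H.ff_eq, abs_mul]
    generalize (cfMatProd Ω m 0 0) = a at *
    generalize (cfMatProd Ω m 0 1) = b at *
    generalize (cfMatProd Ω m 1 0) = c at *
    generalize (cfMatProd Ω m 1 1) = d at *
    have x1 : (c : ℝ) * q + b * p0 Ω q * Ω = Ω * Lc Ω a b d (kzero Ω q) := by
      simp [Lc, kzero]
      linear_combination -q * hquad'
    have x2 : (c : ℝ) + b * Ω ^ 2 = Ω * (2 * b * Ω + a - d) := by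
      linear_combination -hquad'
    have x3 : (q : ℝ) * Ω - p0 Ω q = pairω Ω (kzero Ω q) := by
      simp [pairω, kzero]; ring
    rw [x1, x2, x3, abs_mul, abs_mul, abs_of_pos h0, abs_of_pos hδ]
    field_simp
  have hC : 0 < (1 + Ω) / (2 * (cfMatProd Ω m 0 1) * Ω
        + (cfMatProd Ω m 0 0) - (cfMatProd Ω m 1 1)) := div_pos (by linarith) H.delta_pos
  obtain ⟨hp, hlt⟩ := H.core qh hqh (fun q' hq' => by
    have := hmin q' hq'
    rw [hγ, hγ] at this
    have := le_of_mul_le_mul_right this hC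
    exact_mod_cast this) q hq hnc
  have hp' : (0 : ℝ) < ((|ff (cfMatProd Ω m 0 0) (cfMatProd Ω m 0 1) (cfMatProd Ω m 1 0)
      (cfMatProd Ω m 1 1) (kzero Ω qh)| : ℤ) : ℝ) := by exact_mod_cast hp
  rw [hγ, hγ, mul_div_mul_right _ _ hC.ne', lt_div_iff₀ hp']
  exact hlt
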